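/- For any rotor-router execution and any time T, the state S_T is stable if and only if Σ_{i=1}^{3m} Φ_i(S_T) = Σ_{i=1}^{3m} Φ_i(S_{T+2m²}). -/

import Mathlib

open Finset

namespace RotorRouter

variable {V : Type} [Fintype V] [DecidableEq V] (G : SimpleGraph V) [DecidableRel G.Adj]

/-- The outgoing arcs (darts) of a vertex `v`. -/
def outArcs (v : V) : Finset G.Dart := Finset.univ.filter (fun d => d.fst = v)

/-- The incoming arcs (darts) of a vertex `v`. -/
def inArcs (v : V) : Finset G.Dart := Finset.univ.filter (fun d => d.snd = v)

/-- A state of the rotor-router system: at each vertex, the current pointer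
(represented as an index, in the fixed cyclic order, of an outgoing arc) and the
number of tokens currently located at the vertex. -/
structure State where
  ptr : V → ℕ
  tokens : V → ℕ
  ptr_lt : ∀ v : V, 0 < G.degree v → ptr v < G.degree v

variable (ord : ∀ v : V, Fin (G.degree v) ≃ {d : G.Dart // d.fst = v})

/-- The number of tokens sent out on the `j`-th outgoing arc when `k` tokens leave a
vertex of degree `deg` in round-robin fashion, starting from pointer position `p`. -/
def sentCount (deg p k j : ℕ) : ℕ :=
  ((Finset.range k).filter (fun i => (p + i) % deg = j)).card

/-- The number of tokens sent along the arc `d` during one step from state `S`. -/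
def arcLoad (S : State G) (d : G.Dart) : ℕ :=
  sentCount (G.degree d.fst) (S.ptr d.fst) (S.tokens d.fst)
    (((ord d.fst).symm ⟨d, rfl⟩ : Fin (G.degree d.fst)) : ℕ)

/-- One synchronous step of the rotor-router system: every vertex sends out all of its
tokens in round-robin fashion, advancing its pointer after each token. -/
def step (S : State G) : State G where
  ptr v := if 0 < G.degree v then (S.ptr v + S.tokens v) % G.degree v else S.ptr v
  tokens v := (∑ d ∈ inArcs G v, arcLoad G ord S d) +
    (if 0 < G.degree v then 0 else S.tokens v)
  ptr_lt v h := by simp only [if_pos h]; exact Nat.mod_lt _ h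

/-- `evol S0 t` is the state `S_t` reached after `t` steps from the initial state `S0`. -/
def evol (S0 : State G) (t : ℕ) : State G := (step G ord)^[t] S0

/-- `load S0 t d` is `L_t(d)`, the number of tokens sent along arc `d` during step `t`. -/
def load (S0 : State G) (t : ℕ) (d : G.Dart) : ℕ := arcLoad G ord (evol G ord S0 t) d

/-- `cum S0 t1 t2 d` is the cumulative load `C_{t1}^{t2}(d) = Σ_{t1 ≤ t < t2} L_t(d)`. -/
def cum (S0 : State G) (t1 t2 : ℕ) (d : G.Dart) : ℕ :=
  ∑ t ∈ Finset.Ico t1 t2, load G ord S0 t d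

/-- `cumV S0 t1 t2 v` is the cumulative vertex load `C_{t1}^{t2}(v)`. -/
def cumV (S0 : State G) (t1 t2 : ℕ) (v : V) : ℕ :=
  ∑ t ∈ Finset.Ico t1 t2, (evol G ord S0 t).tokens v

/-- `pot S0 i t` is the `i`-th potential `Φ_i(S_t) = Σ_{e} (C_t^{t+i}(e))²`. -/
def pot (S0 : State G) (i t : ℕ) : ℕ := ∑ d : G.Dart, (cum G ord S0 t (t + i) d) ^ 2

/-- A state `S_t` is stable if it repeats: `S_{t'} = S_t` for some `t' > t`. -/
def IsStable (S0 : State G) (t : ℕ) : Prop :=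
  ∃ t' > t, evol G ord S0 t' = evol G ord S0 t

/-- A family of bijections `in(v) → out(v)` (encoded as a global bijection `M` on darts
with `(M d).fst = d.snd`) is valid w.r.t. the `Δt`-step subcycle decomposition of `S_T`
if `L_t(e) = L_{t+1}(M e)` for all arcs `e` and all `T ≤ t < T + Δt`. -/
def ValidMapping (S0 : State G) (T Δt : ℕ) (M : G.Dart → G.Dart) : Prop :=
  Function.Bijective M ∧ (∀ d : G.Dart, (M d).fst = d.snd) ∧
    ∀ (d : G.Dart) (t : ℕ), T ≤ t → t < T + Δt →
      load G ord S0 t d = load G ord S0 (t + 1) (M d)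

/-- `S_T` admits a `Δt`-step subcycle decomposition. -/
def HasSubcycleDecomp (S0 : State G) (T Δt : ℕ) : Prop :=
  ∃ M : G.Dart → G.Dart, ValidMapping G ord S0 T Δt M


/-- The difference of the cumulative values of two words over `[0, s)`. -/
def diffSum (x y : ℕ → ℕ) (s : ℕ) : ℤ := ∑ t ∈ range s, ((x t : ℤ) - y t)

/-- Two words are balanced on `[a, b]` if their cumulative values over any window
inside `[a, b)` differ by at most one. -/
def BalancedOn (x y : ℕ → ℕ) (a b : ℕ) : Prop :=
  ∀ s u, a ≤ s → s ≤ b → a ≤ u → u ≤ b → diffSum x y u - diffSum x y s ≤ 1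

/-- The permutation `M` carries the letters read at time `t` to those read at time `t + 1`,
for all `a ≤ t < b`. -/
def IsShift {A : Type*} (L : ℕ → A → ℕ) (M : Equiv.Perm A) (a b : ℕ) : Prop :=
  ∀ t d, a ≤ t → t < b → L t d = L (t + 1) (M d)

lemma diffSum_succ (x y : ℕ → ℕ) (s : ℕ) :
    diffSum x y (s + 1) = diffSum x y s + ((x s : ℤ) - y s) :=
  sum_range_succ _ _

lemma diffSum_swap (x y : ℕ → ℕ) (s : ℕ) : diffSum y x s = -diffSum x y s := by
  simp [diffSum]

lemma diffSum_self (x : ℕ → ℕ) (s : ℕ) : diffSum x x s = 0 := by simp [diffSum]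

lemma diffSum_add_sub (x y : ℕ → ℕ) (a i : ℕ) : diffSum x y (a + i) - diffSum x y a =
    (∑ t ∈ range i, x (a + t) : ℕ) - (∑ t ∈ range i, y (a + t) : ℕ) := by
  rw [diffSum, sum_range_add, ← diffSum, add_sub_cancel_left]
  push_cast
  rw [sum_sub_distrib]

lemma balancedOn_of_sum_le {x y : ℕ → ℕ} {a b : ℕ}
    (hxy : ∀ s i, a ≤ s → s + i ≤ b →
      ∑ t ∈ range i, x (s + t) ≤ ∑ t ∈ range i, y (s + t) + 1)
    (hyx : ∀ s i, a ≤ s → s + i ≤ b →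
      ∑ t ∈ range i, y (s + t) ≤ ∑ t ∈ range i, x (s + t) + 1) : BalancedOn x y a b := by
  intro s u hs hs' hu hu'
  rcases le_total s u with h | h
  · obtain ⟨i, rfl⟩ := Nat.exists_eq_add_of_le h
    have := diffSum_add_sub x y s i
    have := hxy s i hs hu'
    omega
  · obtain ⟨i, rfl⟩ := Nat.exists_eq_add_of_le h
    have := diffSum_add_sub x y u i
    have := hyx u i hu hs'
    omega

lemma BalancedOn.symm {x y : ℕ → ℕ} {a b : ℕ} (h : BalancedOn x y a b) : BalancedOn y x a b := by
  intro s u hs hs' hu hu'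
  have := h u s hu hu' hs hs'
  rw [diffSum_swap x y, diffSum_swap x y]
  linarith

lemma BalancedOn.mono {x y : ℕ → ℕ} {a b a' b' : ℕ} (h : BalancedOn x y a b) (ha : a ≤ a')
    (hb : b' ≤ b) : BalancedOn x y a' b' := fun s u h₁ h₂ h₃ h₄ =>
  h s u (ha.trans h₁) (h₂.trans hb) (ha.trans h₃) (h₄.trans hb)

lemma BalancedOn.refl (x : ℕ → ℕ) (a b : ℕ) : BalancedOn x x a b := fun s u _ _ _ _ => by
  simp [diffSum_self]

/-- Balanced words are comparable: one of the two never falls behind the other. -/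
lemma BalancedOn.comparable {x y : ℕ → ℕ} {a b : ℕ} (h : BalancedOn x y a b) :
    (∀ u, a ≤ u → u ≤ b → diffSum x y a ≤ diffSum x y u) ∨
      ∀ u, a ≤ u → u ≤ b → diffSum x y u ≤ diffSum x y a := by
  by_contra! hc
  obtain ⟨⟨u, hu, hu', hlt⟩, w, hw, hw', hlt'⟩ := hc
  have := h u w hu hu' hw hw'
  omega

section Shift

variable {A : Type*} {L : ℕ → A → ℕ} {M : Equiv.Perm A} {a b : ℕ}

lemma IsShift.mono {a' b' : ℕ} (h : IsShift L M a b) (ha : a ≤ a') (hb : b' ≤ b) :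
    IsShift L M a' b' := fun t d h₁ h₂ => h t d (ha.trans h₁) (h₂.trans_le hb)

lemma IsShift.iterate (h : IsShift L M a b) {t : ℕ} (ht : a ≤ t) (d : A) :
    ∀ k, t + k ≤ b → L t d = L (t + k) (M^[k] d)
  | 0, _ => rfl
  | k + 1, hk => by
    rw [h.iterate ht d k (by omega), h (t + k) _ (by omega) (by omega),
      Function.iterate_succ_apply', add_assoc]

lemma IsShift.periodic (h : IsShift L M a b) {t k : ℕ} {d : A} (hd : M^[k] d = d) (ht : a ≤ t)
    (htk : t + k ≤ b) : L (t + k) d = L t d := by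
  rw [h.iterate ht d k htk, hd]

end Shift

lemma perm_minimalPeriod_pos {A : Type*} [Finite A] (M : Equiv.Perm A) (e : A) :
    0 < Function.minimalPeriod M e := by
  refine Function.IsPeriodicPt.minimalPeriod_pos (orderOf_pos M) ?_
  rw [Function.IsPeriodicPt, Function.IsFixedPt, Equiv.Perm.iterate_eq_pow, pow_orderOf_eq_one]
  rfl

lemma card_image_iterate_minimalPeriod {A : Type*} [DecidableEq A] (M : Equiv.Perm A) (e : A) :
    #((range (Function.minimalPeriod M e)).image fun k => M^[k] e) =
      Function.minimalPeriod M e := by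
  rw [card_image_of_injOn, card_range]
  simpa [Set.InjOn] using Function.iterate_injOn_Iio_minimalPeriod (f := M) (x := e)

lemma minimalPeriod_le_card {A : Type*} [Fintype A] (M : Equiv.Perm A) (e : A) :
    Function.minimalPeriod M e ≤ Fintype.card A := by
  classical
  rw [← card_image_iterate_minimalPeriod M e]
  exact card_le_univ _

/-- Two elements lie on a common cycle, or the lengths of their cycles add up to at most the
number of elements. -/
lemma exists_iterate_eq_or_minimalPeriod_add_le {A : Type*} [Fintype A] (M : Equiv.Perm A)
    (e f : A) :
    (∃ k < Function.minimalPeriod M e, M^[k] e = f) ∨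
      Function.minimalPeriod M e + Function.minimalPeriod M f ≤ Fintype.card A := by
  classical
  by_cases h : ∃ k < Function.minimalPeriod M e, M^[k] e = f
  · exact Or.inl h
  right
  rw [← card_image_iterate_minimalPeriod M e, ← card_image_iterate_minimalPeriod M f,
    ← card_union_of_disjoint]
  · exact card_le_univ _
  rw [disjoint_left]
  simp only [mem_image, mem_range, not_exists, not_and]
  rintro _ ⟨k, hk, rfl⟩ j hj hjk
  refine h ⟨(k + (Function.minimalPeriod M f - j)) % Function.minimalPeriod M e,
    Nat.mod_lt _ (perm_minimalPeriod_pos M e), ?_⟩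
  rw [Function.iterate_mod_minimalPeriod_eq, add_comm, Function.iterate_add_apply, ← hjk,
    ← Function.iterate_add_apply, Nat.sub_add_cancel hj.le, Function.iterate_minimalPeriod]

/-- Any two elements have a common period at most the square of half the number of elements. -/
lemma exists_common_period {A : Type*} [Fintype A] (M : Equiv.Perm A) {m : ℕ} (hm : 2 ≤ m)
    (hcard : Fintype.card A = 2 * m) (e f : A) :
    ∃ k, 0 < k ∧ k ≤ m ^ 2 ∧ M^[k] e = e ∧ M^[k] f = f := by
  have he := perm_minimalPeriod_pos M e
  have hf := perm_minimalPeriod_pos M f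
  have pe := Function.isPeriodicPt_minimalPeriod M e
  have pf := Function.isPeriodicPt_minimalPeriod M f
  have hle := minimalPeriod_le_card M e
  rcases exists_iterate_eq_or_minimalPeriod_add_le M e f with ⟨j, -, rfl⟩ | hsum
  · exact ⟨_, he, by nlinarith, pe, pe.apply_iterate j⟩
  · refine ⟨_, Nat.mul_pos he hf, ?_, pe.mul_const _, pf.const_mul _⟩
    rw [hcard] at hsum
    zify at hsum ⊢
    nlinarith [sq_nonneg ((Function.minimalPeriod M e : ℤ) - Function.minimalPeriod M f)]

/-- If two words of a shifted family agree on a long interval, they agree just before it. -/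
lemma IsShift.eq_of_eq_after {A : Type*} [Fintype A] {L : ℕ → A → ℕ} {M : Equiv.Perm A} {a b : ℕ}
    (h : IsShift L M a b) (hb : a + Fintype.card A ≤ b) {e f : A}
    (heq : ∀ t, a < t → t ≤ a + Fintype.card A → L t e = L t f) : L a e = L a f := by
  have he := perm_minimalPeriod_pos M e
  have hf := perm_minimalPeriod_pos M f
  have pe := Function.iterate_minimalPeriod (f := M) (x := e)
  have pf := Function.iterate_minimalPeriod (f := M) (x := f)
  have hle := minimalPeriod_le_card M e
  rcases exists_iterate_eq_or_minimalPeriod_add_le M e f with ⟨k, hk, hkf⟩ | hsum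
  · set l := Function.minimalPeriod M e
    rcases k.eq_zero_or_pos with rfl | hk0
    · rw [← hkf]; rfl
    have hkf' : M^[l - k] f = e := by
      rw [← hkf, ← Function.iterate_add_apply, Nat.sub_add_cancel hk.le, pe]
    have h₁ : L a e = L (a + k) f := hkf ▸ h.iterate le_rfl e k (by omega)
    have h₂ : L a f = L (a + (l - k)) e := by
      have := h.iterate le_rfl f (l - k) (by omega)
      rwa [hkf'] at this
    have h₃ : L (a + k) f = L (a + l) e := by
      have := h.iterate (t := a + k) (by omega) f (l - k) (by omega)
      rwa [hkf', show a + k + (l - k) = a + l by omega] at this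
    have h₄ : L (a + (l - k)) e = L (a + l) f := by
      have := h.iterate (t := a + (l - k)) (by omega) e k (by omega)
      rwa [hkf, show a + (l - k) + k = a + l by omega] at this
    rw [h₁, h₂, h₃, h₄, heq _ (by omega) (by omega)]
  · set l := Function.minimalPeriod M e
    set l' := Function.minimalPeriod M f
    rw [← h.periodic pe le_rfl (by omega), heq _ (by omega) (by omega),
      ← h.periodic pf (by omega) (by omega), ← heq _ (by omega) (by omega), add_right_comm,
      h.periodic pe (by omega) (by omega), heq _ (by omega) (by omega),
      h.periodic pf le_rfl (by omega)]

/-- A violation of balancedness over a shortest window forces the two words to agree strictly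
inside that window. -/
lemma eq_inside_of_minimal_window {x y : ℕ → ℕ} {s u : ℕ}
    (h₁ : BalancedOn x y s (u - 1)) (h₂ : BalancedOn x y (s + 1) u)
    (hv : 2 ≤ diffSum x y u - diffSum x y s) {t : ℕ} (hst : s < t) (htu : t + 1 < u) :
    x t = y t := by
  have a₁ := h₁ s t (by omega) (by omega) (by omega) (by omega)
  have a₂ := h₁ s (t + 1) (by omega) (by omega) (by omega) (by omega)
  have a₃ := h₂ t u (by omega) (by omega) (by omega) (by omega)
  have a₄ := h₂ (t + 1) u (by omega) (by omega) (by omega) (by omega)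
  have := diffSum_succ x y t
  omega

/-- Balancedness over short windows extends to windows of arbitrary length. -/
lemma balancedOn_of_short_windows {A : Type*} [Fintype A] {L : ℕ → A → ℕ} {n T X : ℕ} {e f : A}
    (hn : Fintype.card A < n)
    (hshort : ∀ s u, T ≤ s → u ≤ X → u ≤ s + n → BalancedOn (L · e) (L · f) s u)
    (hshift : ∀ s, T ≤ s → s + n ≤ X → ∃ M, IsShift L M s (s + n)) :
    BalancedOn (L · e) (L · f) T X := by
  suffices H : ∀ k s u, T ≤ s → u ≤ X → u ≤ s + k → BalancedOn (L · e) (L · f) s u from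
    H X T X le_rfl le_rfl (by omega)
  intro k
  induction k with
  | zero => exact fun s u hs hu hk => hshort s u hs hu (by omega)
  | succ k ih =>
    intro s u hs hu hk
    by_cases hsu : u ≤ s + n
    · exact hshort s u hs hu hsu
    have h₁ := ih s (u - 1) hs (by omega) (by omega)
    have h₂ := ih (s + 1) u (by omega) hu (by omega)
    obtain ⟨M, hM⟩ := hshift s hs (by omega)
    have key : ∀ {e f : A}, BalancedOn (L · e) (L · f) s (u - 1) →
        BalancedOn (L · e) (L · f) (s + 1) u →
        diffSum (L · e) (L · f) u - diffSum (L · e) (L · f) s ≤ 1 := by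
      intro e f h₁ h₂
      by_contra! hv
      have heq := hM.eq_of_eq_after (by omega) fun t ht ht' =>
        eq_inside_of_minimal_window h₁ h₂ (by omega) ht (by omega)
      have := diffSum_succ (L · e) (L · f) s
      have := h₂ (s + 1) u le_rfl (by omega) (by omega) le_rfl
      simp only [heq] at *
      omega
    have k₁ := key h₁ h₂
    have k₂ := key h₁.symm h₂.symm
    rw [diffSum_swap (L · e) (L · f), diffSum_swap (L · e) (L · f)] at k₂
    intro p q hp hp' hq hq'
    rcases Nat.lt_or_ge (u - 1) (max p q) with hmax | hmax
    · rcases Nat.lt_or_ge s (min p q) with hmin | hmin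
      · exact h₂ p q (by omega) hp' (by omega) hq'
      · obtain ⟨rfl, rfl⟩ | ⟨rfl, rfl⟩ : p = s ∧ q = u ∨ q = s ∧ p = u := by omega
        · exact k₁
        · linarith
    · exact h₁ p q hp (by omega) hq (by omega)

/-- Balancedness of words with a common period `k` extends by one step. -/
lemma BalancedOn.succ_of_periodic {x y : ℕ → ℕ} {T X k : ℕ} (h : BalancedOn x y T X)
    (hk : 0 < k) (hkX : T + 2 * k ≤ X) (hx : ∀ t, T ≤ t → t + k ≤ X → x (t + k) = x t)
    (hy : ∀ t, T ≤ t → t + k ≤ X → y (t + k) = y t) : BalancedOn x y T (X + 1) := by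
  have hper : ∀ s, T + s + k ≤ X + 1 →
      diffSum x y (T + s + k) - diffSum x y (T + s) = diffSum x y (T + k) - diffSum x y T := by
    intro s
    induction s with
    | zero => intro _; rfl
    | succ s ih =>
      intro hs
      have := ih (by omega)
      have e₁ := diffSum_succ x y (T + s + k)
      have e₂ := diffSum_succ x y (T + s)
      rw [hx (T + s) (by omega) (by omega), hy (T + s) (by omega) (by omega)] at e₁
      rw [show T + (s + 1) + k = T + s + k + 1 by omega, ← add_assoc T s 1]
      omega
  have h₁ := hper k (by omega)
  have h₂ := h T (T + k + k) (by omega) (by omega) (by omega) (by omega)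
  have h₃ := h (T + k + k) T (by omega) (by omega) (by omega) (by omega)
  have h₄ := hper (X + 1 - k - T) (by omega)
  rw [show T + (X + 1 - k - T) = X + 1 - k by omega, show X + 1 - k + k = X + 1 by omega] at h₄
  have hlast : diffSum x y (X + 1) = diffSum x y (X + 1 - k) := by omega
  have key : ∀ s, T ≤ s → s ≤ X + 1 → ∃ s', T ≤ s' ∧ s' ≤ X ∧ diffSum x y s = diffSum x y s' := by
    intro s hs hs'
    rcases Nat.lt_or_ge X s with hX | hX
    · obtain rfl : s = X + 1 := by omega
      exact ⟨X + 1 - k, by omega, by omega, hlast⟩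
    · exact ⟨s, hs, hX, rfl⟩
  intro s u hs hs' hu hu'
  obtain ⟨s₁, hs₁, hs₁', e₁⟩ := key s hs hs'
  obtain ⟨u₁, hu₁, hu₁', e₂⟩ := key u hu hu'
  rw [e₁, e₂]
  exact h s₁ u₁ hs₁ hs₁' hu₁ hu₁'

/-- Two monotone tuples with equal sums and spread at most one coincide. -/
lemma eq_of_monotone_of_sum_eq {ι : Type*} [Fintype ι] [LinearOrder ι] {a b : ι → ℕ}
    (ha : Monotone a) (hb : Monotone b) (ha' : ∀ i j, a i ≤ a j + 1) (hb' : ∀ i j, b i ≤ b j + 1)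
    (hsum : ∑ i, a i = ∑ i, b i) : a = b := by
  have key : ∀ {a b : ι → ℕ}, Monotone a → Monotone b → (∀ i j, a i ≤ a j + 1) →
      (∀ i j, b i ≤ b j + 1) → ∑ i, a i = ∑ i, b i → ∀ k, ¬ a k < b k := by
    intro a b ha hb ha' hb' hsum k hk
    refine (sum_lt_sum (fun i _ => ?_) ⟨k, mem_univ k, hk⟩).ne hsum
    have := ha' i k
    have := hb' k i
    rcases le_total i k with h | h
    · have := ha h
      omega
    · have := hb h
      omega
  funext k
  exact le_antisymm (not_lt.1 (key hb ha hb' ha' hsum.symm k)) (not_lt.1 (key ha hb ha' hb' hsum k))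

/-- A finite family of pairwise comparable functions can be enumerated monotonically. -/
lemma exists_equiv_fin_monotone {B : Type*} [Fintype B] {n N : ℕ} (hn : Fintype.card B = n)
    (F : B → ℕ → ℕ) (hF : ∀ e f, (∀ i ≤ N, F e i ≤ F f i) ∨ ∀ i ≤ N, F f i ≤ F e i) :
    ∃ σ : Fin n ≃ B, ∀ i ≤ N, Monotone fun k => F (σ k) i := by
  let σ := (Fintype.equivFinOfCardEq hn).symm
  let key : Fin n → ℕ := fun k => ∑ i ∈ range (N + 1), F (σ k) i
  refine ⟨(Tuple.sort key).trans σ, fun i hi k l hkl => ?_⟩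
  have hmono : key (Tuple.sort key k) ≤ key (Tuple.sort key l) := Tuple.monotone_sort key hkl
  rcases hF (σ (Tuple.sort key k)) (σ (Tuple.sort key l)) with h | h
  · exact h i hi
  · have hle : ∀ i ∈ range (N + 1), F (σ (Tuple.sort key l)) i ≤ F (σ (Tuple.sort key k)) i :=
      fun i hi => h i (by simpa [Nat.lt_succ_iff] using hi)
    have := (sum_eq_sum_iff_of_le hle).1 (le_antisymm (sum_le_sum hle) hmono)
    exact (this i (by simpa [Nat.lt_succ_iff] using hi)).ge

/-- Two equinumerous balanced families of words with equal total cumulative values can be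
matched so that matched words coincide. -/
lemma exists_equiv_of_balancedOn.{u} {B C : Type u} [Fintype B] [Fintype C]
    (hcard : Fintype.card B = Fintype.card C) {x : B → ℕ → ℕ} {y : C → ℕ → ℕ} {a b : ℕ}
    (hx : ∀ e f, BalancedOn (x e) (x f) a b) (hy : ∀ e f, BalancedOn (y e) (y f) a b)
    (hsum : ∀ t, a ≤ t → t < b → ∑ e, x e t = ∑ e, y e t) :
    ∃ σ : B ≃ C, ∀ e t, a ≤ t → t < b → x e t = y (σ e) t := by
  have hmon : ∀ {B : Type u} {x : B → ℕ → ℕ}, (∀ e f, BalancedOn (x e) (x f) a b) → ∀ e f,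
      (∀ i ≤ b - a, ∑ t ∈ range i, x e (a + t) ≤ ∑ t ∈ range i, x f (a + t)) ∨
        ∀ i ≤ b - a, ∑ t ∈ range i, x f (a + t) ≤ ∑ t ∈ range i, x e (a + t) := by
    intro B x hx e f
    rcases (hx f e).comparable with h | h
    · left
      intro i hi
      rcases i.eq_zero_or_pos with rfl | hi0
      · simp
      have := h (a + i) (by omega) (by omega)
      have := diffSum_add_sub (x f) (x e) a i
      omega
    · right
      intro i hi
      rcases i.eq_zero_or_pos with rfl | hi0
      · simp
      have := h (a + i) (by omega) (by omega)
      have := diffSum_add_sub (x f) (x e) a i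
      omega
  have hspread : ∀ {B : Type u} {x : B → ℕ → ℕ}, (∀ e f, BalancedOn (x e) (x f) a b) → ∀ e f,
      ∀ i ≤ b - a, ∑ t ∈ range i, x e (a + t) ≤ ∑ t ∈ range i, x f (a + t) + 1 := by
    intro B x hx e f i hi
    rcases i.eq_zero_or_pos with rfl | hi0
    · simp
    have := hx e f a (a + i) (by omega) (by omega) (by omega) (by omega)
    have := diffSum_add_sub (x e) (x f) a i
    omega
  obtain ⟨σ, hσ⟩ := exists_equiv_fin_monotone (N := b - a) hcard _ (hmon hx)
  obtain ⟨τ, hτ⟩ := exists_equiv_fin_monotone (N := b - a) rfl _ (hmon hy)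
  have hprefix : ∀ i ≤ b - a, ∀ k,
      ∑ t ∈ range i, x (σ k) (a + t) = ∑ t ∈ range i, y (τ k) (a + t) := by
    intro i hi
    refine congrFun (eq_of_monotone_of_sum_eq (hσ i hi) (hτ i hi)
      (fun _ _ => hspread hx _ _ i hi) (fun _ _ => hspread hy _ _ i hi) ?_)
    rw [Equiv.sum_comp σ fun e => ∑ t ∈ range i, x e (a + t),
      Equiv.sum_comp τ fun e => ∑ t ∈ range i, y e (a + t), sum_comm,
      sum_comm (s := univ) (t := range i)]
    refine sum_congr rfl fun t ht => ?_
    have := mem_range.1 ht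
    exact hsum _ (by omega) (by omega)
  refine ⟨σ.symm.trans τ, fun e t hat htb => ?_⟩
  have h₁ := hprefix (t - a) (by omega) (σ.symm e)
  have h₂ := hprefix (t - a + 1) (by omega) (σ.symm e)
  rw [sum_range_succ, sum_range_succ, h₁, add_right_inj, Equiv.apply_symm_apply,
    Nat.add_sub_cancel' hat] at h₂
  exact h₂

/-- Two equinumerous integer families of equal sum, the second of spread at most one: the second
has the smaller sum of squares, and equality forces spread at most one for the first. -/
lemma sum_sq_le_of_spread.{u} {B C : Type u} [Fintype B] [Fintype C]
    (hcard : Fintype.card B = Fintype.card C) {x : B → ℕ} {y : C → ℕ}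
    (hsum : ∑ e, x e = ∑ e, y e) (hy : ∀ e f, y e ≤ y f + 1) :
    ∑ e, y e ^ 2 ≤ ∑ e, x e ^ 2 ∧
      (∑ e, y e ^ 2 = ∑ e, x e ^ 2 → ∀ e f, x e ≤ x f + 1) := by
  obtain ⟨c, hc⟩ : ∃ c : ℕ, ∀ e, y e = c ∨ y e = c + 1 := by
    rcases isEmpty_or_nonempty C with h | h
    · exact ⟨0, fun e => (IsEmpty.false e).elim⟩
    · obtain ⟨f, hf⟩ := Finite.exists_min y
      refine ⟨y f, fun e => ?_⟩
      have := hf e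
      have := hy e f
      omega
  have expand : ∀ {B : Type u} [Fintype B] (x : B → ℕ),
      ∑ e, ((x e : ℤ) - c) * (x e - c - 1) = ((∑ e, x e ^ 2 : ℕ) : ℤ) -
        (2 * c + 1) * (∑ e, x e : ℕ) + Fintype.card B * (c * (c + 1)) := by
    intro B _ x
    push_cast
    rw [mul_sum, ← sum_sub_distrib, ← nsmul_eq_mul, ← card_univ, ← sum_const, ← sum_add_distrib]
    exact sum_congr rfl fun e _ => by ring
  have hnonneg : ∀ e, 0 ≤ ((x e : ℤ) - c) * (x e - c - 1) := by
    intro e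
    rcases le_or_gt (x e : ℤ) c with h | h <;> nlinarith
  have hzero : ∑ e, ((y e : ℤ) - c) * (y e - c - 1) = 0 :=
    sum_eq_zero fun e _ => by rcases hc e with h | h <;> simp [h]
  have hx := expand x
  have hy := expand y
  rw [hzero, ← hcard, ← hsum] at hy
  constructor
  · have := sum_nonneg fun e (_ : e ∈ univ) => hnonneg e
    zify
    push_cast at *
    linarith
  · intro heq
    have hx0 : ∑ e, ((x e : ℤ) - c) * (x e - c - 1) = 0 := by rw [hx, ← heq, ← hy]
    have hall := (sum_eq_zero_iff_of_nonneg fun e _ => hnonneg e).1 hx0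
    have hval : ∀ e, (x e : ℤ) = c ∨ (x e : ℤ) = c + 1 := fun e => by
      rcases mul_eq_zero.1 (hall e (mem_univ e)) with h | h
      · left; linarith
      · right; linarith
    intro e f
    have := hval e
    have := hval f
    omega

lemma sentCount_eq_count (deg p k j : ℕ) :
    sentCount deg p k j = Nat.count (fun i => (p + i) % deg = j) k :=
  (Nat.count_eq_card_filter_range _ _).symm

lemma sentCount_add (deg p k l j : ℕ) :
    sentCount deg p (k + l) j = sentCount deg p k j + sentCount deg ((p + k) % deg) l j := by
  simp_rw [sentCount_eq_count, Nat.count_add, Nat.mod_add_mod, add_assoc]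

lemma sentCount_le_succ {deg j j' : ℕ} (p k : ℕ) (hj : j < deg) (hj' : j' < deg) :
    sentCount deg p k j ≤ sentCount deg p k j' + 1 := by
  have hcount : ∀ j < deg, p / deg + (if j < p % deg then 1 else 0) + sentCount deg p k j =
      (p + k) / deg + if j < (p + k) % deg then 1 else 0 := by
    intro j hj
    have h := fun n => Nat.count_modEq_card n (Nat.zero_lt_of_lt hj) j
    simp only [Nat.ModEq, Nat.mod_eq_of_lt hj] at h
    rw [sentCount_eq_count, ← h, ← h, Nat.count_add]
  have h₁ := hcount j hj
  have h₂ := hcount j' hj'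
  split_ifs at h₁ h₂ <;> omega

lemma sum_sentCount {deg : ℕ} (hdeg : 0 < deg) (p k : ℕ) :
    ∑ j : Fin deg, sentCount deg p k j = k := by
  rw [Fin.sum_univ_eq_sum_range fun j => sentCount deg p k j]
  conv_rhs => rw [← card_range k]
  exact (card_eq_sum_card_fiberwise fun i _ =>
    mem_coe.2 (mem_range.2 (Nat.mod_lt (p + i) hdeg))).symm

variable {G}

lemma card_fst_fiber (v : V) : Fintype.card {d : G.Dart // d.fst = v} = G.degree v := by
  rw [Fintype.card_subtype, G.dart_fst_fiber_card_eq_degree]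

lemma card_snd_fiber (v : V) :
    Fintype.card {d : G.Dart // d.snd = v} = Fintype.card {d : G.Dart // d.fst = v} :=
  Fintype.card_congr (SimpleGraph.Dart.symm_involutive.toPerm.subtypeEquiv fun _ => Iff.rfl)

variable {ord}

lemma arcLoad_eq (S : State G) {v : V} (d : {d : G.Dart // d.fst = v}) :
    arcLoad G ord S d = sentCount (G.degree v) (S.ptr v) (S.tokens v) ((ord v).symm d) := by
  obtain ⟨d, rfl⟩ := d
  rfl

lemma sum_arcLoad_fst (S : State G) {v : V} (hv : 0 < G.degree v) :
    ∑ d : {d : G.Dart // d.fst = v}, arcLoad G ord S d = S.tokens v := by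
  simp_rw [arcLoad_eq]
  rw [Equiv.sum_comp (ord v).symm fun j =>
    sentCount (G.degree v) (S.ptr v) (S.tokens v) (j : ℕ), sum_sentCount hv]

lemma evol_succ (S0 : State G) (t : ℕ) :
    evol G ord S0 (t + 1) = step G ord (evol G ord S0 t) :=
  Function.iterate_succ_apply' _ _ _

lemma evol_add (S0 : State G) (s t : ℕ) :
    evol G ord S0 (s + t) = evol G ord (evol G ord S0 s) t := by
  rw [evol, add_comm, Function.iterate_add_apply]
  rfl

/-- The tokens arriving at a vertex during a step are sent out during the next step. -/
lemma sum_load_snd (S0 : State G) (t : ℕ) (v : V) :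
    ∑ d : {d : G.Dart // d.snd = v}, load G ord S0 t d =
      ∑ d : {d : G.Dart // d.fst = v}, load G ord S0 (t + 1) d := by
  rcases (G.degree v).eq_zero_or_pos with hv | hv
  · have h₁ : IsEmpty {d : G.Dart // d.fst = v} := by
      rw [← Fintype.card_eq_zero_iff, card_fst_fiber, hv]
    have h₂ : IsEmpty {d : G.Dart // d.snd = v} := by
      rw [← Fintype.card_eq_zero_iff, card_snd_fiber, card_fst_fiber, hv]
    simp
  · simp_rw [load]
    rw [sum_arcLoad_fst _ hv, evol_succ]
    simp only [step, hv, if_true, add_zero, inArcs]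
    exact (sum_subtype _ (by simp) fun d => arcLoad G ord (evol G ord S0 t) d).symm

lemma ptr_add (S0 : State G) (s i : ℕ) {v : V} (hv : 0 < G.degree v) :
    (evol G ord S0 (s + i)).ptr v = ((evol G ord S0 s).ptr v +
      ∑ t ∈ range i, (evol G ord S0 (s + t)).tokens v) % G.degree v := by
  induction i with
  | zero => simpa using (Nat.mod_eq_of_lt ((evol G ord S0 s).ptr_lt v hv)).symm
  | succ i ih =>
    rw [← add_assoc, evol_succ, sum_range_succ, ← add_assoc, Nat.add_mod, ← ih]
    simp [step, hv]

lemma sum_load_eq_sentCount (S0 : State G) (s i : ℕ) {v : V} (hv : 0 < G.degree v)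
    (d : {d : G.Dart // d.fst = v}) :
    ∑ t ∈ range i, load G ord S0 (s + t) d =
      sentCount (G.degree v) ((evol G ord S0 s).ptr v)
        (∑ t ∈ range i, (evol G ord S0 (s + t)).tokens v) ((ord v).symm d) := by
  induction i with
  | zero => simp [sentCount]
  | succ i ih => rw [sum_range_succ, sum_range_succ, sentCount_add, ih, ← ptr_add S0 s i hv, load,
      arcLoad_eq]

lemma sum_load_le_succ (S0 : State G) (s i : ℕ) {d e : G.Dart} (hde : d.fst = e.fst) :
    ∑ t ∈ range i, load G ord S0 (s + t) d ≤ ∑ t ∈ range i, load G ord S0 (s + t) e + 1 := by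
  have hpos : 0 < G.degree e.fst := Fin.pos ((ord e.fst).symm ⟨e, rfl⟩)
  rw [sum_load_eq_sentCount S0 s i hpos ⟨d, hde⟩, sum_load_eq_sentCount S0 s i hpos ⟨e, rfl⟩]
  exact sentCount_le_succ _ _ (Fin.is_lt _) (Fin.is_lt _)

/-- If the loads of the incoming arcs of every vertex are balanced, then they are permuted into
the loads of the outgoing arcs of the following steps. -/
lemma exists_isShift (S0 : State G) {a b : ℕ}
    (h : ∀ d e : G.Dart, d.snd = e.snd →
      BalancedOn (load G ord S0 · d) (load G ord S0 · e) a b) :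
    ∃ M, IsShift (load G ord S0) M a b := by
  have hv : ∀ v : V, ∃ σ : {d : G.Dart // d.snd = v} ≃ {d : G.Dart // d.fst = v},
      ∀ (d : {d : G.Dart // d.snd = v}) t, a ≤ t → t < b →
        load G ord S0 t d = load G ord S0 (t + 1) (σ d) := by
    intro v
    refine exists_equiv_of_balancedOn (card_snd_fiber v)
      (x := fun (d : {d : G.Dart // d.snd = v}) t => load G ord S0 t d)
      (y := fun (d : {d : G.Dart // d.fst = v}) t => load G ord S0 (t + 1) d)
      (fun d e => h d e (d.2.trans e.2.symm)) (fun d e => ?_) fun t _ _ => sum_load_snd S0 t v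
    have key : ∀ (d e : {d : G.Dart // d.fst = v}) (s i : ℕ),
        ∑ t ∈ range i, load G ord S0 (s + t + 1) d ≤
          ∑ t ∈ range i, load G ord S0 (s + t + 1) e + 1 := fun d e s i => by
      simpa only [add_right_comm] using
        sum_load_le_succ S0 (s + 1) i (d.2.trans e.2.symm)
    exact balancedOn_of_sum_le (fun s i _ _ => key d e s i) fun s i _ _ => key e d s i
  choose σ hσ using hv
  refine ⟨(Equiv.sigmaFiberEquiv fun d : G.Dart => d.snd).symm.trans
    ((Equiv.sigmaCongrRight σ).trans (Equiv.sigmaFiberEquiv fun d : G.Dart => d.fst)),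
    fun t d ht ht' => hσ d.snd ⟨d, rfl⟩ t ht ht'⟩

lemma cum_add (S0 : State G) (t i : ℕ) (d : G.Dart) :
    cum G ord S0 t (t + i) d = ∑ k ∈ range i, load G ord S0 (t + k) d := by
  rw [cum, sum_Ico_eq_sum_range, Nat.add_sub_cancel_left]

/-- Potentials never increase, and a constant potential means that the incoming arcs of every
vertex have balanced cumulative loads. -/
lemma pot_succ_le (S0 : State G) (i t : ℕ) :
    pot G ord S0 i (t + 1) ≤ pot G ord S0 i t ∧
      (pot G ord S0 i (t + 1) = pot G ord S0 i t → ∀ d e : G.Dart, d.snd = e.snd →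
        ∑ k ∈ range i, load G ord S0 (t + k) d ≤
          ∑ k ∈ range i, load G ord S0 (t + k) e + 1) := by
  have hv := fun v : V => sum_sq_le_of_spread (card_snd_fiber v)
    (x := fun d : {d : G.Dart // d.snd = v} => ∑ k ∈ range i, load G ord S0 (t + k) d)
    (y := fun d : {d : G.Dart // d.fst = v} => ∑ k ∈ range i, load G ord S0 (t + 1 + k) d)
    (by
      rw [sum_comm, sum_comm (s := univ) (t := range i)]
      refine sum_congr rfl fun k _ => ?_
      rw [sum_load_snd, add_right_comm])
    fun d e => sum_load_le_succ S0 (t + 1) i (d.2.trans e.2.symm)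
  simp_rw [pot, cum_add]
  rw [← Fintype.sum_fiberwise (fun d : G.Dart => d.fst),
    ← Fintype.sum_fiberwise (fun d : G.Dart => d.snd)]
  refine ⟨sum_le_sum fun v _ => (hv v).1, fun heq d e hde => ?_⟩
  have := (sum_eq_sum_iff_of_le fun v _ => (hv v).1).1 heq e.snd (mem_univ _)
  exact (hv e.snd).2 this ⟨d, hde⟩ ⟨e, rfl⟩

lemma pot_antitone (S0 : State G) (i : ℕ) : Antitone (pot G ord S0 i) :=
  antitone_nat_of_succ_le fun t => (pot_succ_le S0 i t).1

lemma pot_congr {S0 : State G} {s t : ℕ} (h : evol G ord S0 s = evol G ord S0 t) (i : ℕ) :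
    pot G ord S0 i s = pot G ord S0 i t := by
  simp_rw [pot, cum_add, load, evol_add, h]

lemma IsStable.pot_eq {S0 : State G} {T : ℕ} (h : IsStable G ord S0 T) (i n : ℕ) :
    pot G ord S0 i T = pot G ord S0 i (T + n) := by
  obtain ⟨t', ht', heq⟩ := h
  obtain ⟨p, rfl⟩ := Nat.exists_eq_add_of_lt ht'
  have hrep : ∀ k, evol G ord S0 (T + k * (p + 1)) = evol G ord S0 T := by
    intro k
    induction k with
    | zero => simp
    | succ k ih => rw [Nat.succ_mul, ← add_assoc, evol_add, ih, ← evol_add, ← add_assoc, heq]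
  refine le_antisymm ?_ (pot_antitone S0 i (Nat.le_add_right T n))
  rw [← pot_congr (hrep n) i]
  exact pot_antitone S0 i (by nlinarith)

@[ext]
lemma State.ext {S S' : State G} (hp : S.ptr = S'.ptr) (ht : S.tokens = S'.tokens) :
    S = S' := by
  cases S
  cases S'
  subst hp ht
  rfl

lemma evol_of_degree_eq_zero (S0 : State G) (t : ℕ) {v : V} (hv : G.degree v = 0) :
    (evol G ord S0 t).ptr v = S0.ptr v ∧ (evol G ord S0 t).tokens v = S0.tokens v := by
  induction t with
  | zero => exact ⟨rfl, rfl⟩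
  | succ t ih =>
    have h : IsEmpty {d : G.Dart // d.snd = v} := by
      rw [← Fintype.card_eq_zero_iff, card_snd_fiber, card_fst_fiber, hv]
    have hin : inArcs G v = ∅ := filter_eq_empty_iff.2 fun d _ hd => h.false ⟨d, hd⟩
    rw [evol_succ]
    simpa [step, hv, hin] using ih

/-- A state from which on all loads are periodic is stable. -/
lemma isStable_of_periodic {S0 : State G} {T P : ℕ} (hP : 0 < P)
    (h : ∀ t d, T ≤ t → load G ord S0 (t + P) d = load G ord S0 t d) : IsStable G ord S0 T := by
  have htok : ∀ t v, T ≤ t → (evol G ord S0 (t + P)).tokens v = (evol G ord S0 t).tokens v := by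
    intro t v ht
    rcases (G.degree v).eq_zero_or_pos with hv | hv
    · rw [(evol_of_degree_eq_zero S0 _ hv).2, (evol_of_degree_eq_zero S0 _ hv).2]
    · rw [← sum_arcLoad_fst _ hv, ← sum_arcLoad_fst (ord := ord) _ hv]
      exact sum_congr rfl fun d _ => h t d ht
  have htok' : ∀ n t v, T ≤ t →
      (evol G ord S0 (t + n * P)).tokens v = (evol G ord S0 t).tokens v := by
    intro n t v ht
    induction n with
    | zero => simp
    | succ n ih => rw [Nat.succ_mul, ← add_assoc, htok _ _ (by omega), ih]
  have hsum : ∀ n v, ∑ t ∈ range (n * P), (evol G ord S0 (T + t)).tokens v =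
      n * ∑ t ∈ range P, (evol G ord S0 (T + t)).tokens v := by
    intro n v
    induction n with
    | zero => simp
    | succ n ih =>
      rw [Nat.succ_mul, sum_range_add, ih, Nat.succ_mul]
      congr 1
      refine sum_congr rfl fun t _ => ?_
      rw [← htok' n (T + t) v (by omega), add_assoc, add_comm t]
  refine ⟨T + (Fintype.card V).factorial * P,
    Nat.lt_add_of_pos_right (Nat.mul_pos (Nat.factorial_pos _) hP), ?_⟩
  ext v
  · rcases (G.degree v).eq_zero_or_pos with hv | hv
    · rw [(evol_of_degree_eq_zero S0 _ hv).1, (evol_of_degree_eq_zero S0 _ hv).1]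
    · obtain ⟨c, hc⟩ := Nat.dvd_factorial hv (G.degree_lt_card_verts v).le
      rw [ptr_add S0 T _ hv, hsum, hc, mul_assoc, Nat.add_mul_mod_self_left,
        Nat.mod_eq_of_lt ((evol G ord S0 T).ptr_lt v hv)]
  · exact htok' _ T v le_rfl

lemma two_le_card_edgeFinset {d e : G.Dart} (hne : d ≠ e) (h : d.snd = e.snd) :
    2 ≤ #G.edgeFinset := by
  have h₁ : d ≠ d.symm := d.symm_ne.symm
  have h₂ : e ≠ d.symm := by
    rintro rfl
    exact d.fst_ne_snd h.symm
  have hcard : #{d, e, d.symm} ≤ Fintype.card G.Dart := card_le_univ _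
  rw [card_eq_three.2 ⟨d, e, d.symm, hne, h₁, h₂, rfl⟩, G.dart_card_eq_twice_card_edges] at hcard
  omega

/-- Incoming arcs that are balanced over `2 m ^ 2` steps are balanced forever. -/
lemma balancedOn_forever (S0 : State G) {T : ℕ}
    (h : ∀ d e : G.Dart, d.snd = e.snd → BalancedOn (load G ord S0 · d) (load G ord S0 · e) T
      (T + 2 * #G.edgeFinset ^ 2)) {X : ℕ} (hX : T + 2 * #G.edgeFinset ^ 2 ≤ X) :
    ∀ d e : G.Dart, d.snd = e.snd →
      BalancedOn (load G ord S0 · d) (load G ord S0 · e) T X := by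
  induction X, hX using Nat.le_induction with
  | base => exact h
  | succ X hX ih =>
    intro d e hde
    rcases eq_or_ne d e with rfl | hne
    · exact BalancedOn.refl _ _ _
    obtain ⟨M, hM⟩ := exists_isShift S0 ih
    obtain ⟨k, hk, hkm, hd, he⟩ := exists_common_period M (two_le_card_edgeFinset hne hde)
      G.dart_card_eq_twice_card_edges d e
    exact (ih d e hde).succ_of_periodic hk (by omega)
      (fun t ht htk => hM.periodic hd ht htk) fun t ht htk => hM.periodic he ht htk

/-- A state whose incoming arcs are balanced over `2 m ^ 2` steps is stable. -/
lemma isStable_of_balancedOn {S0 : State G} {T : ℕ}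
    (h : ∀ d e : G.Dart, d.snd = e.snd → BalancedOn (load G ord S0 · d) (load G ord S0 · e) T
      (T + 2 * #G.edgeFinset ^ 2)) : IsStable G ord S0 T := by
  obtain ⟨M, hM⟩ : ∃ M, ∀ X, IsShift (load G ord S0) M T X := by
    by_contra! hc
    choose X hX using hc
    obtain ⟨M, hM⟩ := exists_isShift S0
      (balancedOn_forever S0 h (Nat.le_add_right _ (univ.sup X)))
    exact hX M (hM.mono le_rfl ((le_sup (mem_univ M)).trans (Nat.le_add_left _ _)))
  refine isStable_of_periodic (orderOf_pos M) fun t d ht =>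
    (hM (t + orderOf M)).periodic ?_ ht le_rfl
  rw [Equiv.Perm.iterate_eq_pow, pow_orderOf_eq_one]
  rfl

/-- Constant potentials make the incoming arcs balanced. -/
lemma balancedOn_of_pot_eq {S0 : State G} {T X : ℕ}
    (h : ∀ i ∈ Icc 1 (3 * #G.edgeFinset), pot G ord S0 i T = pot G ord S0 i X) {d e : G.Dart}
    (hde : d.snd = e.snd) : BalancedOn (load G ord S0 · d) (load G ord S0 · e) T X := by
  have hshort : ∀ s u, T ≤ s → u ≤ X → u ≤ s + 3 * #G.edgeFinset → ∀ d e : G.Dart,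
      d.snd = e.snd → BalancedOn (load G ord S0 · d) (load G ord S0 · e) s u := by
    intro s u hs hu hsu
    have key : ∀ d e : G.Dart, d.snd = e.snd → ∀ s' i, s ≤ s' → s' + i ≤ u →
        ∑ k ∈ range i, load G ord S0 (s' + k) d ≤
          ∑ k ∈ range i, load G ord S0 (s' + k) e + 1 := by
      intro d e hde s' i hs' hi
      rcases i.eq_zero_or_pos with rfl | hi0
      · simp
      refine (pot_succ_le S0 i s').2 (le_antisymm (pot_succ_le S0 i s').1 ?_) d e hde
      calc pot G ord S0 i s' ≤ pot G ord S0 i T := pot_antitone S0 i (by omega)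
        _ = pot G ord S0 i X := h i (mem_Icc.2 (by omega))
        _ ≤ pot G ord S0 i (s' + 1) := pot_antitone S0 i (by omega)
    exact fun d e hde => balancedOn_of_sum_le (key d e hde) (key e d hde.symm)
  have hpos : 0 < Fintype.card G.Dart := Fintype.card_pos_iff.2 ⟨d⟩
  have hcard := G.dart_card_eq_twice_card_edges
  exact balancedOn_of_short_windows (n := 3 * #G.edgeFinset) (by omega)
    (fun s u hs hu hsu => hshort s u hs hu hsu d e hde)
    fun s hs hsX => exists_isShift S0 (hshort s _ hs hsX le_rfl)

variable (G ord)

/-- `S_T` is stable iff `Σ_{i=1}^{3m} Φ_i(S_T) = Σ_{i=1}^{3m} Φ_i(S_{T+2m²})`. -/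
theorem stable_iff_potential_sum_constant (hconn : G.Connected) (S0 : State G) (T : ℕ) :
    IsStable G ord S0 T ↔
      ∑ i ∈ Finset.Icc 1 (3 * G.edgeFinset.card), pot G ord S0 i T =
        ∑ i ∈ Finset.Icc 1 (3 * G.edgeFinset.card),
          pot G ord S0 i (T + 2 * G.edgeFinset.card ^ 2) := by
  refine ⟨fun h => sum_congr rfl fun i _ => h.pot_eq i _, fun h => ?_⟩
  have hterm := (sum_eq_sum_iff_of_le fun i _ =>
    pot_antitone S0 i (Nat.le_add_right T (2 * #G.edgeFinset ^ 2))).1 h.symm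
  exact isStable_of_balancedOn fun d e hde =>
    balancedOn_of_pot_eq (fun i hi => (hterm i hi).symm) hde

end RotorRouter
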